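/- The modular discriminant Δ is a modular form of weight 12 for SL₂(ℤ): for every matrix γ = (a b; c d) in SL₂(ℤ) and every τ in the complex upper half-plane ℍ, Δ((aτ + b)/(cτ + d)) = (cτ + d)^{12} · Δ(τ). -/

import Mathlib

open Complex

/-- The modular discriminant `Δ(τ) = (2π)^12 · q · ∏_{n=1}^∞ (1 - qⁿ)^24`
where `q = exp(2πiτ)`. -/
noncomputable def modularDelta (τ : UpperHalfPlane) : ℂ :=
  (2 * Real.pi) ^ 12 * Complex.exp (2 * Real.pi * Complex.I * τ) *
    ∏' n : ℕ, (1 - Complex.exp (2 * Real.pi * Complex.I * τ) ^ (n + 1)) ^ 24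

theorem modularDelta_eq_discriminant (z : UpperHalfPlane) :
    modularDelta z = (2 * Real.pi) ^ 12 * ModularForm.discriminant z := by
  rw [ModularForm.discriminant_eq_q_prod, modularDelta, mul_assoc]
  simp [ModularForm.eta_q, Function.Periodic.qParam]

/-- `Δ` is a modular form of weight 12 for `SL₂(ℤ)`:
`Δ((aτ+b)/(cτ+d)) = (cτ+d)^12 Δ(τ)`. -/
theorem modularDelta_weight_twelve
    (a b c d : ℤ) (h : a * d - b * c = 1) (τ τ' : UpperHalfPlane)
    (hτ' : (τ' : ℂ) = ((a : ℂ) * τ + b) / ((c : ℂ) * τ + d)) :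
    modularDelta τ' = ((c : ℂ) * τ + d) ^ 12 * modularDelta τ := by
  have hdet : (!![a, b; c, d] : Matrix (Fin 2) (Fin 2) ℤ).det = 1 := by
    rw [Matrix.det_fin_two_of]; exact h
  let γ : Matrix.SpecialLinearGroup (Fin 2) ℤ := ⟨!![a, b; c, d], hdet⟩
  have hs := congrFun (SlashInvariantForm.slash_action_generators_SL2Z ModularForm.discriminant_S_invariant
    ModularForm.discriminant_T_invariant γ) τ
  rw [ModularForm.SL_slash_apply] at hs
  have hsm : γ • τ = τ' := by
    apply UpperHalfPlane.ext
    rw [hτ', UpperHalfPlane.specialLinearGroup_apply]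
    simp [γ]
  have hden : UpperHalfPlane.denom γ τ = (c : ℂ) * τ + d := by
    rw [ModularGroup.denom_apply]; simp [γ]
  have hne : (c : ℂ) * τ + d ≠ 0 := hden ▸ UpperHalfPlane.denom_ne_zero γ τ
  rw [hsm, hden] at hs
  rw [modularDelta_eq_discriminant, modularDelta_eq_discriminant, ← hs]
  rw [zpow_neg, show ((12 : ℤ)) = ((12 : ℕ) : ℤ) from rfl, zpow_natCast]
  field_simp
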